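/- arXiv:1609.00424 — 2 statements merged into one kernel-verified Lean document; each statement's English description precedes it below -/
import Mathlib

section
/- For any real λ with 0 < λ < 1, the function p(x) defined by p(0) = e^{-λ}, p(1) = λe^{-λ}, and p(x) = ((x-1)^{x-2} / (x·(x-2)!)) · λ^x · e^{-xλ} for integers x ≥ 2 is a probability mass function, i.e., ∑_{x=0}^∞ p(x) = 1. -/
noncomputable def cc (n : ℕ) : ℝ := (n : ℝ) ^ n / (n.factorial : ℝ)

lemma cc_nonneg (n : ℕ) : 0 ≤ cc n := by unfold cc; positivity

lemma cc_le (n : ℕ) : cc n ≤ Real.exp 1 ^ n := by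
  have := Real.pow_div_factorial_le_exp (x := (n : ℝ)) (by positivity) n
  unfold cc
  rw [← Real.exp_nat_mul, mul_one]
  exact this

lemma cc_bound (r : ℝ) (hr : 0 ≤ r) (n : ℕ) : cc n * r ^ n ≤ (Real.exp 1 * r) ^ n := by
  rw [mul_pow]
  exact mul_le_mul_of_nonneg_right (cc_le n) (by positivity)

lemma cc_summable (r : ℝ) (hr : 0 ≤ r) (h : Real.exp 1 * r < 1) :
    Summable (fun n => cc n * r ^ n) :=
  Summable.of_nonneg_of_le (fun n => mul_nonneg (cc_nonneg n) (by positivity))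
    (cc_bound r hr) (summable_geometric_of_lt_one (by positivity) h)

noncomputable def SS (z : ℝ) : ℝ := ∑' n, cc n * z ^ n
noncomputable def FF (z : ℝ) : ℝ := ∑' n : ℕ, cc n / ((n : ℝ) + 1) * z ^ (n + 1)

lemma exists_r (z : ℝ) (hz : Real.exp 1 * |z| < 1) :
    ∃ r : ℝ, |z| < r ∧ Real.exp 1 * r < 1 := by
  have he := Real.exp_pos 1
  have : |z| < 1 / Real.exp 1 := by rw [lt_div_iff₀ he]; linarith
  obtain ⟨r, h1, h2⟩ := exists_between this
  refine ⟨r, h1, ?_⟩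
  rw [lt_div_iff₀ he] at h2; linarith

lemma SS_analytic (z : ℝ) (hz : Real.exp 1 * |z| < 1) : AnalyticAt ℝ SS z := by
  obtain ⟨r, h1, h2⟩ := exists_r z hz
  have hr : 0 < r := lt_of_le_of_lt (abs_nonneg z) h1
  set p := FormalMultilinearSeries.ofScalars ℝ cc with hp
  have hrad : ((Real.toNNReal r : NNReal) : ENNReal) ≤ p.radius := by
    apply p.le_radius_of_bound 1
    intro n
    rw [Real.coe_toNNReal r hr.le, hp, FormalMultilinearSeries.ofScalars_norm, Real.norm_of_nonneg (cc_nonneg n)]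
    exact (cc_bound r hr.le n).trans (pow_le_one₀ (by positivity) h2.le)
  have hpos : 0 < p.radius := lt_of_lt_of_le (by
    rw [ENNReal.coe_pos]; exact Real.toNNReal_pos.2 hr) hrad
  have h := p.hasFPowerSeriesOnBall hpos
  have hS : p.sum = SS := by
    have := FormalMultilinearSeries.ofScalarsSum_eq_tsum (E := ℝ) cc
    unfold FormalMultilinearSeries.ofScalarsSum at this
    rw [hp, this]
    rfl
  rw [hS] at h
  apply h.analyticAt_of_mem
  refine Metric.eball_subset_eball hrad ?_
  rw [Metric.eball_coe, Metric.mem_ball, Real.coe_toNNReal r hr.le]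
  simpa using h1

lemma FF_summable (z : ℝ) (hz : Real.exp 1 * |z| < 1) :
    Summable (fun n : ℕ => cc n / ((n : ℝ) + 1) * z ^ (n + 1)) := by
  refine Summable.of_norm_bounded ((cc_summable |z| (abs_nonneg z) hz).mul_right |z|) ?_
  intro n
  rw [norm_mul, norm_pow, Real.norm_eq_abs z, pow_succ, ← mul_assoc]
  gcongr
  rw [Real.norm_of_nonneg (div_nonneg (cc_nonneg n) (by positivity))]
  exact div_le_self (cc_nonneg n) (by linarith [(Nat.cast_nonneg n : (0:ℝ) ≤ n)])

lemma FF_deriv (z : ℝ) (hz : Real.exp 1 * |z| < 1) : HasDerivAt FF (SS z) z := by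
  obtain ⟨r, h1, h2⟩ := exists_r z hz
  have hr : 0 < r := lt_of_le_of_lt (abs_nonneg z) h1
  refine hasDerivAt_tsum_of_isPreconnected (g := fun (n : ℕ) z => cc n / ((n : ℝ) + 1) * z ^ (n + 1))
    (g' := fun n z => cc n * z ^ n) (t := Metric.ball (0:ℝ) r)
    (cc_summable r hr.le h2) Metric.isOpen_ball
    (convex_ball (0:ℝ) r).isPreconnected ?_ ?_ (y₀ := z) ?_ (FF_summable z hz) ?_
  · intro n y _
    have := (hasDerivAt_pow (n + 1) y).const_mul (cc n / ((n : ℝ) + 1))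
    have e : cc n / ((n : ℝ) + 1) * (((n + 1 : ℕ) : ℝ) * y ^ (n + 1 - 1)) = cc n * y ^ n := by
      have : (n : ℝ) + 1 ≠ 0 := by positivity
      push_cast
      field_simp
    rw [e] at this
    exact this
  · intro n y hy
    rw [norm_mul, norm_pow, Real.norm_of_nonneg (cc_nonneg n)]
    have : ‖y‖ < r := by simpa using hy
    have := cc_nonneg n
    gcongr
  · simpa using h1
  · simpa using h1

lemma exp_bd : Real.exp (1 + 1/4) < 4 := by
  have h1 := Real.exp_one_lt_d9
  have h2 : Real.exp (1/4) ≤ 4/3 := by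
    have h := Real.add_one_le_exp (-(1/4:ℝ))
    rw [Real.exp_neg] at h
    have hp := Real.exp_pos (1/4)
    rw [le_inv_comm₀ (by norm_num) hp] at h
    norm_num at h ⊢
    exact h
  rw [Real.exp_add]
  have := Real.exp_pos (1/4)
  nlinarith

lemma dom (l : ℝ) (h0 : -(1/4) < l) (h1 : l < 1) :
    Real.exp 1 * |l * Real.exp (-l)| < 1 := by
  rw [abs_mul, abs_of_pos (Real.exp_pos _)]
  have e : Real.exp 1 * (|l| * Real.exp (-l)) = |l| * Real.exp (1 - l) := by
    rw [sub_eq_add_neg, Real.exp_add]; ring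
  rw [e]
  rcases le_or_gt 0 l with h | h
  · rw [abs_of_nonneg h]
    have h3 := Real.add_one_lt_exp (x := l - 1) (by linarith)
    have h4 : Real.exp (l - 1) * Real.exp (1 - l) = 1 := by
      rw [← Real.exp_add]; simp
    have h5 : l < Real.exp (l - 1) := by linarith
    have h6 := mul_lt_mul_of_pos_right h5 (Real.exp_pos (1 - l))
    linarith
  · rw [abs_of_neg h]
    have h3 : Real.exp (1 - l) ≤ Real.exp (1 + 1/4) := Real.exp_le_exp.2 (by linarith)
    have := exp_bd
    have := Real.exp_pos (1 - l)
    nlinarith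

noncomputable def dbl (l : ℝ) (x : ℕ × ℕ) : ℝ :=
  cc x.1 * l ^ x.1 * ((-(x.1 : ℝ) * l) ^ x.2 / (x.2.factorial : ℝ))

lemma hasSum_exp (x : ℝ) : HasSum (fun j : ℕ => x ^ j / (j.factorial : ℝ)) (Real.exp x) := by
  rw [Real.exp_eq_exp_ℝ]
  exact NormedSpace.expSeries_div_hasSum_exp x

lemma dbl_row (l : ℝ) (n : ℕ) :
    HasSum (fun j => dbl l (n, j)) (cc n * (l * Real.exp (-l)) ^ n) := by
  have := (hasSum_exp (-(n : ℝ) * l)).mul_left (cc n * l ^ n)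
  have e : cc n * (l * Real.exp (-l)) ^ n = cc n * l ^ n * Real.exp (-(n : ℝ) * l) := by
    rw [mul_pow, ← Real.exp_nat_mul, mul_assoc]
    congr 3
    ring
  rw [e]
  exact this

lemma dbl_summable (l : ℝ) (hl : |l| < 1/4) : Summable (dbl l) := by
  rw [← summable_norm_iff]
  have key : ∀ n j, ‖dbl l (n, j)‖ = cc n * |l| ^ n * (((n : ℝ) * |l|) ^ j / (j.factorial : ℝ)) := by
    intro n j
    simp [dbl, abs_mul, abs_div, abs_pow, abs_of_nonneg (cc_nonneg n)]
  have row : ∀ n, HasSum (fun j => ‖dbl l (n, j)‖) (cc n * (|l| * Real.exp |l|) ^ n) := by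
    intro n
    simp_rw [key]
    have := (hasSum_exp ((n : ℝ) * |l|)).mul_left (cc n * |l| ^ n)
    have e : cc n * (|l| * Real.exp |l|) ^ n = cc n * |l| ^ n * Real.exp ((n : ℝ) * |l|) := by
      rw [mul_pow, ← Real.exp_nat_mul, mul_assoc]
    rw [e]
    exact this
  rw [summable_prod_of_nonneg (fun _ => norm_nonneg _)]
  refine ⟨fun n => (row n).summable, ?_⟩
  simp_rw [fun n => (row n).tsum_eq]
  apply cc_summable _ (by positivity)
  have e : Real.exp 1 * (|l| * Real.exp |l|) = |l| * Real.exp (1 + |l|) := by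
    rw [Real.exp_add]; ring
  rw [e]
  have h3 : Real.exp (1 + |l|) ≤ Real.exp (1 + 1/4) := Real.exp_le_exp.2 (by linarith)
  have := exp_bd
  have := Real.exp_pos (1 + |l|)
  nlinarith [abs_nonneg l]

lemma dbl_diag (l : ℝ) (m : ℕ) : ∑ x ∈ Finset.HasAntidiagonal.antidiagonal m, dbl l x = l ^ m := by
  have h := congrFun (fwdDiff_iter_eq_factorial (R := ℝ) (n := m)) 0
  rw [fwdDiff_iter_eq_sum_shift] at h
  rw [Finset.Nat.sum_antidiagonal_eq_sum_range_succ_mk]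
  have hm : (m.factorial : ℝ) ≠ 0 := by positivity
  have : ∑ k ∈ Finset.range m.succ, dbl l (k, m - k) = l ^ m / (m.factorial : ℝ) *
      ∑ k ∈ Finset.range (m + 1), ((-1 : ℤ) ^ (m - k) * m.choose k) • ((0:ℝ) + k • (1:ℝ)) ^ m := by
    rw [Finset.mul_sum]
    refine Finset.sum_congr rfl fun k hk => ?_
    have hk : k ≤ m := by simpa [Nat.lt_succ_iff] using hk
    have hc : ((m.choose k : ℕ) : ℝ) = m.factorial / (k.factorial * (m - k).factorial) :=
      Nat.cast_choose ℝ hk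
    obtain ⟨j, rfl⟩ := Nat.exists_eq_add_of_le hk
    simp only [Nat.add_sub_cancel_left] at hc ⊢
    simp only [dbl, cc, zsmul_eq_mul, nsmul_eq_mul]
    push_cast
    rw [hc]
    have h1 : (k.factorial : ℝ) ≠ 0 := by positivity
    have h2 : (j.factorial : ℝ) ≠ 0 := by positivity
    field_simp
    ring
  rw [this, h]
  simp only [Pi.natCast_apply]
  field_simp

lemma SS_near (l : ℝ) (hl : |l| < 1/4) : SS (l * Real.exp (-l)) = (1 - l)⁻¹ := by
  have hs := dbl_summable l hl
  have e1 : ∑' x, dbl l x = SS (l * Real.exp (-l)) := by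
    rw [hs.tsum_prod' (fun n => (dbl_row l n).summable)]
    exact tsum_congr fun n => (dbl_row l n).tsum_eq
  have e2 : ∑' x, dbl l x = ∑' m : ℕ, l ^ m := by
    rw [← Finset.HasAntidiagonal.sigmaAntidiagonalEquivProd.tsum_eq (dbl l)]
    have hs' := (Finset.HasAntidiagonal.sigmaAntidiagonalEquivProd (A := ℕ)).summable_iff.2 hs
    refine (hs'.tsum_sigma' (fun n => (hasSum_fintype _).summable)).trans ?_
    refine tsum_congr fun m => ?_
    rw [← dbl_diag l m, tsum_fintype, ← Finset.sum_coe_sort (Finset.HasAntidiagonal.antidiagonal m)]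
    rfl
  rw [← e1, e2, tsum_geometric_of_abs_lt_one (by linarith)]

lemma SS_eq (l : ℝ) (h0 : -(1/4) < l) (h1 : l < 1) :
    SS (l * Real.exp (-l)) = (1 - l)⁻¹ := by
  have hf : AnalyticOnNhd ℝ (fun l => SS (l * Real.exp (-l))) (Set.Ioo (-(1/4)) 1) := by
    intro x hx
    have hg : AnalyticAt ℝ (fun l : ℝ => l * Real.exp (-l)) x := by fun_prop
    exact AnalyticAt.fun_comp (SS_analytic _ (dom x hx.1 hx.2)) hg
  have hg : AnalyticOnNhd ℝ (fun l : ℝ => (1 - l)⁻¹) (Set.Ioo (-(1/4)) 1) := by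
    intro x hx
    have : (1:ℝ) - x ≠ 0 := by linarith [hx.2]
    exact AnalyticAt.inv (by fun_prop) this
  refine hf.eqOn_of_preconnected_of_eventuallyEq hg isPreconnected_Ioo (z₀ := 0)
    (by norm_num) ?_ ⟨h0, h1⟩
  filter_upwards [Metric.ball_mem_nhds (0:ℝ) (show (0:ℝ) < 1/4 by norm_num)] with x hx
  exact SS_near x (by simpa using hx)

lemma FF_eq (l : ℝ) (h0 : 0 < l) (h1 : l < 1) :
    FF (l * Real.exp (-l)) = 1 - Real.exp (-l) := by
  have hd : ∀ x ∈ Set.Ioo (-(1/4):ℝ) 1,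
      HasDerivAt (fun l => FF (l * Real.exp (-l)) + Real.exp (-l)) 0 x := by
    intro x hx
    have he : HasDerivAt (fun l : ℝ => Real.exp (-l)) (-Real.exp (-x)) x := by
      simpa using (hasDerivAt_neg x).exp
    have hg := (hasDerivAt_id x).mul he
    have hc := (HasDerivAt.comp x (FF_deriv _ (dom x hx.1 hx.2)) hg).add he
    have e : SS ((id * fun l => Real.exp (-l) : ℝ → ℝ) x) * (1 * Real.exp (-x) + id x * -Real.exp (-x))
        + -Real.exp (-x) = 0 := by
      have h2 : SS ((id * fun l => Real.exp (-l) : ℝ → ℝ) x) = (1 - x)⁻¹ := SS_eq x hx.1 hx.2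
      rw [h2]
      have : (1:ℝ) - x ≠ 0 := by linarith [hx.2]
      simp only [id]
      field_simp
      ring
    rw [e] at hc
    exact hc
  have := isOpen_Ioo.is_const_of_deriv_eq_zero isPreconnected_Ioo
    (fun x hx => (hd x hx).differentiableAt.differentiableWithinAt)
    (fun x hx => (hd x hx).deriv) (x := l) (y := 0) ⟨by linarith, h1⟩ (by norm_num)
  have hF0 : FF 0 = 0 := by simp [FF]
  simp [hF0] at this
  linarith

/-- The inter-decode-time distribution is a pmf: for `0 < λ < 1`,
`p(0) = e^{-λ}`, `p(1) = λe^{-λ}`,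
`p(x) = (x-1)^{x-2} λ^x e^{-xλ} / (x (x-2)!)` for `x ≥ 2`, sums to 1. -/
theorem stmt0 (lam : ℝ) (h0 : 0 < lam) (h1 : lam < 1) :
    ∑' x : ℕ,
      (if x = 0 then Real.exp (-lam)
       else if x = 1 then lam * Real.exp (-lam)
       else (((x - 1 : ℕ) ^ (x - 2) : ℕ) : ℝ) / ((x : ℝ) * (Nat.factorial (x - 2)))
            * lam ^ x * Real.exp (-(x : ℝ) * lam)) = 1 := by
  set f : ℕ → ℝ := fun x => (if x = 0 then Real.exp (-lam)
       else if x = 1 then lam * Real.exp (-lam)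
       else (((x - 1 : ℕ) ^ (x - 2) : ℕ) : ℝ) / ((x : ℝ) * (Nat.factorial (x - 2)))
            * lam ^ x * Real.exp (-(x : ℝ) * lam)) with hf
  have hshift : ∀ n : ℕ, f (n + 1) = cc n / ((n : ℝ) + 1) * (lam * Real.exp (-lam)) ^ (n + 1) := by
    intro n
    rcases n with _ | k
    · simp [hf, cc]
    · have e : Real.exp (-(((k + 1 + 1 : ℕ)) : ℝ) * lam) = Real.exp (-lam) ^ (k + 1 + 1) := by
        rw [← Real.exp_nat_mul]; congr 1; ring
      simp only [hf]
      rw [if_neg (by omega), if_neg (by omega), e, mul_pow]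
      have e2 : k + 1 + 1 - 1 = k + 1 := by omega
      have e3 : k + 1 + 1 - 2 = k := by omega
      rw [e2, e3, cc, Nat.factorial_succ]
      push_cast
      have hk : (k.factorial : ℝ) ≠ 0 := by positivity
      field_simp
      ring
  have hdom := dom lam (by linarith) h1
  have hs : Summable (fun n => f (n + 1)) := by
    simp_rw [hshift]; exact FF_summable _ hdom
  have hs' : Summable f := (summable_nat_add_iff 1).1 hs
  rw [hs'.tsum_eq_zero_add]
  simp_rw [hshift]
  have := FF_eq lam h0 h1
  unfold FF at this
  rw [this]
  simp [hf]
end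

section
/- Let λ ∈ (0,1) and let X be a random variable on the nonnegative integers with P(X=0) = e^{-λ}, P(X=1) = λe^{-λ}, and P(X=x) = ((x-1)^{x-2} / (x·(x-2)!)) λ^x e^{-xλ} for x ≥ 2. Then E[X] = (λ/(1-λ)) e^{-λ}. -/
noncomputable def abelCoef (n : ℕ) : ℝ := (n : ℝ) ^ n / (Nat.factorial n)

lemma abelCoef_nonneg (n : ℕ) : 0 ≤ abelCoef n := by unfold abelCoef; positivity

lemma abelCoef_le (n : ℕ) : abelCoef n ≤ Real.exp 1 ^ n := by
  unfold abelCoef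
  have := Real.pow_div_factorial_le_exp (x := (n : ℝ)) (by positivity) n
  rwa [← Real.exp_nat_mul, mul_one]

lemma abel_summable (z : ℝ) (hz0 : 0 ≤ z) (hz : Real.exp 1 * z < 1) :
    Summable fun n => abelCoef n * z ^ n := by
  refine Summable.of_nonneg_of_le (fun n => mul_nonneg (abelCoef_nonneg n) (by positivity))
    (fun n => ?_) (summable_geometric_of_lt_one (by positivity) hz)
  rw [mul_pow]
  exact mul_le_mul_of_nonneg_right (abelCoef_le n) (by positivity)

lemma abel_fin (m : ℕ) : ∑ k ∈ Finset.range (m + 1),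
    (k : ℝ) ^ m * (-1) ^ (m - k) / (k.factorial * (m - k).factorial) = 1 := by
  have h := congrFun (fwdDiff_iter_eq_factorial (R := ℝ) (n := m)) 0
  rw [fwdDiff_iter_eq_sum_shift] at h
  have hm : (m.factorial : ℝ) ≠ 0 := by positivity
  have h2 : ∑ k ∈ Finset.range (m + 1),
    (k : ℝ) ^ m * (-1) ^ (m - k) / (k.factorial * (m - k).factorial) = (m.factorial : ℝ) / m.factorial := by
    have h' : ((m.factorial : ℕ) : ℝ) = ((m.factorial : ℝ → ℝ)) 0 := by simp
    conv_rhs => enter [1]; rw [h', ← h]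
    rw [Finset.sum_div]
    refine Finset.sum_congr rfl fun k hk => ?_
    have hk : k ≤ m := by simpa [Nat.lt_succ_iff] using hk
    have hc : (m.choose k : ℝ) * k.factorial * (m - k).factorial = m.factorial := by
      exact_mod_cast Nat.choose_mul_factorial_mul_factorial hk
    simp only [zsmul_eq_mul, nsmul_eq_mul, mul_one, zero_add]
    push_cast
    rw [div_eq_div_iff (by positivity) hm, ← hc]
    ring
  rw [h2, div_self hm]

lemma abel_small (l : ℝ) (h0 : 0 < l) (h1 : l < 1 / 9) :
    ∑' n, abelCoef n * (l * Real.exp (-l)) ^ n = (1 - l)⁻¹ := by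
  let f : ℕ × ℕ → ℝ := fun p => abelCoef p.1 * l ^ p.1 * ((-(p.1 * l)) ^ p.2 / (p.2.factorial))
  have hexp : ∀ x : ℝ, HasSum (fun k : ℕ => x ^ k / (k.factorial : ℝ)) (Real.exp x) := fun x => by
    rw [Real.exp_eq_exp_ℝ]
    exact NormedSpace.exp_series_hasSum_exp' x |>.congr_fun fun _ => by
      rw [smul_eq_mul, div_eq_inv_mul]
  have hnorm : ∀ p, ‖f p‖ = abelCoef p.1 * l ^ p.1 * ((p.1 * l) ^ p.2 / (p.2.factorial)) := by
    intro p
    simp only [f, norm_mul, norm_div, norm_pow, norm_neg, Real.norm_eq_abs, Nat.abs_cast,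
      abs_of_pos h0, abs_of_nonneg (abelCoef_nonneg _)]
  have hs : Summable f := by
    apply Summable.of_norm
    rw [summable_prod_of_nonneg (fun _ => norm_nonneg _)]
    simp only [hnorm]
    refine ⟨fun n => ((hexp _).summable).mul_left _, ?_⟩
    simp only [tsum_mul_left, (hexp _).tsum_eq]
    have hz : Real.exp 1 * (l * Real.exp l) < 1 := by
      have a := Real.exp_one_lt_three
      have b : Real.exp l ≤ Real.exp 1 := Real.exp_le_exp.2 (by linarith)
      have c := Real.exp_pos 1
      have d := Real.exp_pos l
      have : Real.exp 1 * Real.exp l ≤ 9 := by nlinarith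
      nlinarith
    refine (abel_summable (l * Real.exp l) (by positivity) hz).congr fun n => ?_
    rw [mul_pow, ← Real.exp_nat_mul, mul_assoc]
  have e1 : ∑' p, f p = ∑' n, abelCoef n * (l * Real.exp (-l)) ^ n := by
    rw [hs.tsum_prod]
    refine tsum_congr fun n => ?_
    simp only [f, tsum_mul_left, (hexp _).tsum_eq]
    rw [mul_pow, ← Real.exp_nat_mul, mul_assoc, mul_neg]
  have e2 : ∑' p, f p = ∑' m : ℕ, l ^ m := by
    rw [← Finset.HasAntidiagonal.sigmaAntidiagonalEquivProd.tsum_eq f]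
    have hs' := (Finset.HasAntidiagonal.sigmaAntidiagonalEquivProd (A := ℕ)).summable_iff.2 hs
    refine (Summable.tsum_sigma' (fun m => (hasSum_fintype _).summable) hs').trans ?_
    refine tsum_congr fun m => ?_
    rw [tsum_fintype]
    have : ∑ b : Finset.HasAntidiagonal.antidiagonal m, f b.1 = l ^ m := by
      rw [Finset.sum_coe_sort (Finset.HasAntidiagonal.antidiagonal m) f,
        Finset.Nat.sum_antidiagonal_eq_sum_range_succ_mk]
      conv_rhs => rw [← mul_one (l ^ m), ← abel_fin m, Finset.mul_sum]
      refine Finset.sum_congr rfl fun k hk => ?_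
      have hk : k ≤ m := by simpa [Nat.lt_succ_iff] using hk
      obtain ⟨j, rfl⟩ := Nat.exists_eq_add_of_le hk
      simp only [f, abelCoef, Nat.add_sub_cancel_left]
      rw [neg_pow, mul_pow, pow_add, pow_add]
      field_simp
    exact this
  rw [← e1, e2, tsum_geometric_of_lt_one h0.le (by linarith)]

lemma exp_z_lt (l : ℝ) (h1 : l < 1) : l * Real.exp (-l) < Real.exp (-1) := by
  have h := Real.add_one_lt_exp (x := l - 1) (by linarith)
  have e : Real.exp (-1) = Real.exp (l - 1) * Real.exp (-l) := by
    rw [← Real.exp_add]; ring_nf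
  rw [e]
  exact mul_lt_mul_of_pos_right (by linarith) (Real.exp_pos _)

lemma abel_analytic (z : ℝ) (h0 : 0 ≤ z) (hz : z < Real.exp (-1)) :
    AnalyticAt ℝ (fun z : ℝ => ∑' n, abelCoef n * z ^ n) z := by
  let p := FormalMultilinearSeries.ofScalars ℝ abelCoef
  have hr : (((NNReal.mk (Real.exp (-1)) (Real.exp_pos _).le : NNReal)) : ENNReal) ≤ p.radius := by
    refine p.le_radius_of_bound 1 fun n => ?_
    have : ‖p n‖ = abelCoef n := by
      rw [FormalMultilinearSeries.ofScalars_norm, Real.norm_of_nonneg (abelCoef_nonneg n)]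
    rw [this]
    calc abelCoef n * Real.exp (-1) ^ n ≤ Real.exp 1 ^ n * Real.exp (-1) ^ n :=
          mul_le_mul_of_nonneg_right (abelCoef_le n) (by positivity)
      _ = 1 := by rw [← mul_pow, ← Real.exp_add]; simp
  have hlt : ENNReal.ofReal z < p.radius := by
    refine lt_of_lt_of_le ?_ hr
    rw [ENNReal.ofReal, ENNReal.coe_lt_coe, ← NNReal.coe_lt_coe, Real.coe_toNNReal _ h0]
    exact hz
  have hp := p.hasFPowerSeriesOnBall (lt_of_le_of_lt zero_le hlt)
  have ha := hp.analyticAt_of_mem (y := z) (by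
    rw [Metric.mem_eball, edist_dist, dist_zero_right, Real.norm_of_nonneg h0]
    exact hlt)
  refine ha.congr (Filter.Eventually.of_forall fun x => ?_)
  simp [FormalMultilinearSeries.sum, p, mul_comm]

lemma abel_main (l : ℝ) (h0 : 0 < l) (h1 : l < 1) :
    ∑' n, abelCoef n * (l * Real.exp (-l)) ^ n = (1 - l)⁻¹ := by
  have hF : AnalyticOnNhd ℝ (fun l : ℝ => ∑' n, abelCoef n * (l * Real.exp (-l)) ^ n)
      (Set.Ioo 0 1) := by
    intro x hx
    have hx0 := hx.1
    exact AnalyticAt.fun_comp (f := fun l : ℝ => l * Real.exp (-l))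
      (abel_analytic _ (by positivity) (exp_z_lt x hx.2)) (by fun_prop)
  have hG : AnalyticOnNhd ℝ (fun l : ℝ => (1 - l)⁻¹) (Set.Ioo 0 1) := by
    intro x hx
    exact AnalyticAt.inv (by fun_prop) (by have := hx.2; intro h; linarith)
  refine hF.eqOn_of_preconnected_of_eventuallyEq hG isPreconnected_Ioo
    (z₀ := 1 / 10) (by norm_num) ?_ ⟨h0, h1⟩
  filter_upwards [Ioo_mem_nhds (show (0 : ℝ) < 1 / 10 by norm_num)
    (show (1 / 10 : ℝ) < 1 / 9 by norm_num)] with x hx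
  exact abel_small x hx.1 hx.2

/-- First moment of the inter-decode-time distribution:
`E[X] = (λ/(1-λ)) e^{-λ}`. -/
theorem stmt2 (lam : ℝ) (h0 : 0 < lam) (h1 : lam < 1) :
    ∑' x : ℕ, (x : ℝ) *
      (if x = 0 then Real.exp (-lam)
       else if x = 1 then lam * Real.exp (-lam)
       else (((x - 1 : ℕ) ^ (x - 2) : ℕ) : ℝ) / ((x : ℝ) * (Nat.factorial (x - 2)))
            * lam ^ x * Real.exp (-(x : ℝ) * lam))
    = (lam / (1 - lam)) * Real.exp (-lam) := by
  have hz : Real.exp 1 * (lam * Real.exp (-lam)) < 1 := by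
    have := mul_lt_mul_of_pos_left (exp_z_lt lam h1) (Real.exp_pos 1)
    rwa [← Real.exp_add, add_neg_cancel, Real.exp_zero] at this
  have hs := (abel_summable (lam * Real.exp (-lam)) (by positivity) hz).hasSum
  rw [abel_main lam h0 h1] at hs
  have hs2 := hs.mul_left (lam * Real.exp (-lam))
  have e : lam / (1 - lam) * Real.exp (-lam) = lam * Real.exp (-lam) * (1 - lam)⁻¹ := by
    rw [div_eq_mul_inv]; ring
  rw [e]
  apply HasSum.tsum_eq
  rw [← hasSum_nat_add_iff' 1]
  simp only [Finset.range_one, Finset.sum_singleton, Nat.cast_zero, zero_mul, sub_zero]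
  refine hs2.congr_fun fun n => ?_
  rcases n with _ | n
  · simp [abelCoef]
  · have a1 : n + 1 + 1 - 1 = n + 1 := rfl
    have a2 : n + 1 + 1 - 2 = n := rfl
    rw [if_neg (by omega), if_neg (by omega), a1, a2]
    have ee : Real.exp (-((n + 1 + 1 : ℕ) : ℝ) * lam) = Real.exp (-lam) ^ (n + 1 + 1) := by
      rw [← Real.exp_nat_mul]; ring_nf
    rw [ee, abelCoef, Nat.factorial_succ]
    push_cast
    have : (n : ℝ) + 1 ≠ 0 := by positivity
    have : (n : ℝ) + 1 + 1 ≠ 0 := by positivity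
    field_simp
    ring
end
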